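/- arXiv:2206.09095 — 2 statements merged into one kernel-verified Lean document; each statement's English description precedes it below -/
import Mathlib

section
/- For every γ > γ₀ there exists a unique β ∈ ℝ, denoted g(γ), such that (β, γ, …, γ) ∈ Γ and f(β, γ, …, γ) = 1; moreover g(c_*) = c_*, and g(γ) < c_* for every γ > c_*. -/
open Set Filter

/-- The vector `(β, γ, …, γ) ∈ ℝⁿ`: first coordinate `β`, all remaining coordinates `γ`. -/
def vec (n : ℕ) (β γ : ℝ) : Fin n → ℝ := fun j => if (j : ℕ) = 0 then β else γ

/-- An open convex cone containing the open positive orthant absorbs nonnegative vectors. -/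
theorem add_nonneg_mem_of_orthant_subset {n : ℕ} {Γ : Set (Fin n → ℝ)} (hopen : IsOpen Γ)
    (hconv : Convex ℝ Γ) (hcone : ∀ x ∈ Γ, ∀ t : ℝ, 0 < t → t • x ∈ Γ)
    (horth : {x : Fin n → ℝ | ∀ j, 0 < x j} ⊆ Γ) {x d : Fin n → ℝ} (hx : x ∈ Γ) (hd : 0 ≤ d) :
    x + d ∈ Γ := by
  have hcont : Continuous fun t : ℝ => x - t • (1 : Fin n → ℝ) := by fun_prop
  have hev : ∀ᶠ t in nhds (0 : ℝ), x - t • (1 : Fin n → ℝ) ∈ Γ :=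
    hcont.continuousAt.eventually_mem (hopen.mem_nhds (by simpa using hx))
  obtain ⟨ε, hεmem, hε⟩ :=
    ((hev.filter_mono nhdsWithin_le_nhds).and (self_mem_nhdsWithin (s := Ioi (0 : ℝ)))).exists
  have hε : 0 < ε := hε
  have hpos : d + ε • (1 : Fin n → ℝ) ∈ Γ := horth fun j => by
    have := hd j
    simp only [Pi.zero_apply] at this
    simp only [Pi.add_apply, Pi.smul_apply, Pi.one_apply, smul_eq_mul]
    linarith
  have hmid := hcone _ (hconv hεmem hpos (by norm_num : (0 : ℝ) ≤ 1 / 2)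
    (by norm_num : (0 : ℝ) ≤ 1 / 2) (by norm_num)) 2 (by norm_num)
  convert hmid using 1
  module

/-- A function with positive partial derivatives on an upward closed open set is strictly
monotone there. -/
theorem lt_of_lt_of_fderiv_single_pos {n : ℕ} {Γ : Set (Fin n → ℝ)} (hopen : IsOpen Γ)
    (hadd : ∀ x ∈ Γ, ∀ d : Fin n → ℝ, 0 ≤ d → x + d ∈ Γ) {f : (Fin n → ℝ) → ℝ}
    (hdiff : DifferentiableOn ℝ f Γ)
    (hpos : ∀ x ∈ Γ, ∀ j : Fin n, 0 < fderiv ℝ f x (Pi.single j 1))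
    {x y : Fin n → ℝ} (hx : x ∈ Γ) (hxy : x < y) : f x < f y := by
  obtain ⟨hle, k, hk⟩ := Pi.lt_def.1 hxy
  have hseg : ∀ t ∈ Icc (0 : ℝ) 1, x + t • (y - x) ∈ Γ := fun t ht =>
    hadd x hx _ (smul_nonneg ht.1 (sub_nonneg.2 hle))
  have hderiv : ∀ t ∈ Icc (0 : ℝ) 1, HasDerivAt (fun t : ℝ => f (x + t • (y - x)))
      (fderiv ℝ f (x + t • (y - x)) (y - x)) t := fun t ht => by
    have hline : HasDerivAt (fun t : ℝ => x + t • (y - x)) (y - x) t := by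
      simpa using ((hasDerivAt_id t).smul_const (y - x)).const_add x
    exact ((hdiff.differentiableAt (hopen.mem_nhds (hseg t ht))).hasFDerivAt).comp_hasDerivAt
      t hline
  have hmono : StrictMonoOn (fun t : ℝ => f (x + t • (y - x))) (Icc 0 1) := by
    refine strictMonoOn_of_deriv_pos (convex_Icc 0 1)
      (fun t ht => (hderiv t ht).continuousAt.continuousWithinAt) fun t ht => ?_
    have ht := interior_subset ht
    have hL := hpos _ (hseg t ht)
    rw [(hderiv t ht).deriv]
    generalize fderiv ℝ f (x + t • (y - x)) = L at hL ⊢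
    rw [pi_eq_sum_univ' (y - x), map_sum]
    refine Finset.sum_pos' (fun j _ => ?_) ⟨k, Finset.mem_univ k, ?_⟩
    · rw [map_smul, smul_eq_mul]
      exact mul_nonneg (sub_nonneg.2 (hle j)) (hL j).le
    · rw [map_smul, smul_eq_mul]
      exact mul_pos (sub_pos.2 hk) (hL k)
  simpa using hmono (left_mem_Icc.2 zero_le_one) (right_mem_Icc.2 zero_le_one) zero_lt_one

theorem continuous_vec (n : ℕ) (γ : ℝ) : Continuous fun β => vec n β γ := by
  refine continuous_pi fun j => ?_
  unfold vec
  split_ifs <;> fun_prop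

theorem vec_self (n : ℕ) (c : ℝ) : vec n c c = fun _ => c := by
  funext j
  simp [vec]

theorem vec_mono (n : ℕ) {β β' γ γ' : ℝ} (hβ : β ≤ β') (hγ : γ ≤ γ') :
    vec n β γ ≤ vec n β' γ' := by
  intro j
  unfold vec
  split_ifs <;> assumption

theorem vec_lt_vec_left {n : ℕ} (hn : 0 < n) {β β' : ℝ} (γ : ℝ) (hβ : β < β') :
    vec n β γ < vec n β' γ :=
  Pi.lt_def.2 ⟨vec_mono n hβ.le le_rfl, ⟨0, hn⟩, by simpa [vec] using hβ⟩

theorem vec_lt_vec_right {n : ℕ} (hn : 2 ≤ n) {β β' γ γ' : ℝ} (hβ : β ≤ β') (hγ : γ < γ') :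
    vec n β γ < vec n β' γ' :=
  Pi.lt_def.2 ⟨vec_mono n hβ hγ.le, ⟨1, hn⟩, by simpa [vec] using hγ⟩

theorem sum_vec {n : ℕ} (hn : 0 < n) (β γ : ℝ) :
    ∑ j, vec n β γ j = β + (n - 1) * γ := by
  obtain ⟨m, rfl⟩ := Nat.exists_eq_succ_of_ne_zero hn.ne'
  simp [vec, Fin.sum_univ_succ]

/-- Every level below `f (vec n β₁ γ)` is attained when decreasing the first coordinate
towards the boundary of the cone, where `f` vanishes. -/
theorem exists_vec_mem_eq {n : ℕ} (hn : 0 < n) {Γ : Set (Fin n → ℝ)} (hopen : IsOpen Γ)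
    (hadd : ∀ x ∈ Γ, ∀ d : Fin n → ℝ, 0 ≤ d → x + d ∈ Γ)
    (hsum : Γ ⊆ {x : Fin n → ℝ | 0 < ∑ j, x j}) {f : (Fin n → ℝ) → ℝ}
    (hcont : ContinuousOn f (closure Γ)) (hbd : ∀ x ∈ frontier Γ, f x = 0)
    {β₁ γ c : ℝ} (hmem : vec n β₁ γ ∈ Γ) (hc : 0 < c) (hcle : c ≤ f (vec n β₁ γ)) :
    ∃ β, vec n β γ ∈ Γ ∧ f (vec n β γ) = c := by
  set S : Set ℝ := (fun β => vec n β γ) ⁻¹' Γ with hS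
  have hSopen : IsOpen S := hopen.preimage (continuous_vec n γ)
  have hSne : S.Nonempty := ⟨β₁, hmem⟩
  have hSbdd : BddBelow S := ⟨-((n - 1) * γ), fun β hβ => by
    have h : 0 < ∑ j, vec n β γ j := hsum hβ
    rw [sum_vec hn] at h
    linarith⟩
  have hup : ∀ β ∈ S, ∀ β', β ≤ β' → β' ∈ S := fun β hβ β' hle => by
    have h := hadd _ hβ _ (sub_nonneg.2 (vec_mono n hle (le_refl γ)))
    rwa [add_sub_cancel] at h
  have hIoi : ∀ β, sInf S < β → β ∈ S := fun β hβ => by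
    obtain ⟨β', hβ', hlt⟩ := exists_lt_of_csInf_lt hSne hβ
    exact hup β' hβ' β hlt.le
  have hcl : vec n (sInf S) γ ∈ closure Γ :=
    (continuous_vec n γ).closure_preimage_subset Γ (csInf_mem_closure hSne hSbdd)
  have hnot : sInf S ∉ S := fun h => by
    obtain ⟨l, hl, hlS⟩ := exists_Ioc_subset_of_mem_nhds (hSopen.mem_nhds h) (exists_lt _)
    obtain ⟨m, hlm, hm⟩ := exists_between hl
    exact (csInf_le hSbdd (hlS ⟨hlm, hm.le⟩)).not_gt hm
  have hzero : f (vec n (sInf S) γ) = 0 := hbd _ (by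
    rw [hopen.frontier_eq]
    exact ⟨hcl, hnot⟩)
  have hcontIcc : ContinuousOn (fun β => f (vec n β γ)) (Icc (sInf S) β₁) := by
    refine hcont.comp (continuous_vec n γ).continuousOn fun β hβ => ?_
    rcases hβ.1.eq_or_lt with h | h
    · rwa [← h]
    · exact subset_closure (hIoi β h)
  obtain ⟨β, hβ, hfβ⟩ := intermediate_value_Icc (csInf_le hSbdd hmem) hcontIcc
    (show c ∈ Icc _ _ from ⟨by simpa only [hzero] using hc.le, hcle⟩)
  refine ⟨β, hIoi β (lt_of_le_of_ne hβ.1 ?_), hfβ⟩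
  rintro rfl
  exact hc.ne' (hfβ.symm.trans hzero)

/-- For every `γ > γ₀` there is a unique `β = g(γ)` with `(β, γ, …, γ) ∈ Γ` and
`f(β, γ, …, γ) = 1`; moreover `g(c_*) = c_*` and `g(γ) < c_*` for `γ > c_*`. -/
theorem stmt2 (n : ℕ) (hn : 2 ≤ n)
    (Γ : Set (Fin n → ℝ))
    (hΓopen : IsOpen Γ)
    (hΓconv : Convex ℝ Γ)
    (hΓcone : ∀ x ∈ Γ, ∀ t : ℝ, 0 < t → t • x ∈ Γ)
    (hΓsym : ∀ σ : Equiv.Perm (Fin n), ∀ x ∈ Γ, (x ∘ σ) ∈ Γ)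
    (hΓ1 : {x : Fin n → ℝ | ∀ j, 0 < x j} ⊆ Γ)
    (hΓ2 : Γ ⊆ {x : Fin n → ℝ | 0 < ∑ j, x j})
    (f : (Fin n → ℝ) → ℝ)
    (hfsmooth : ContDiffOn ℝ (⊤ : ℕ∞) f Γ)
    (hfcont : ContinuousOn f (closure Γ))
    (hfsym : ∀ σ : Equiv.Perm (Fin n), ∀ x : Fin n → ℝ, f (x ∘ σ) = f x)
    (hfconc : ConcaveOn ℝ Γ f)
    (hfpos : ∀ x ∈ Γ, 0 < f x)
    (hfbd : ∀ x ∈ frontier Γ, f x = 0)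
    (hfmono : ∀ x ∈ Γ, ∀ j : Fin n, 0 < fderiv ℝ f x (Pi.single j 1))
    (cstar : ℝ) (hcstar : 0 < cstar)
    (hfcstar : f (fun _ => cstar) = 1)
    (γ₀ : ℝ)
    (hγ₀ : γ₀ = sInf {γ : ℝ | 0 < γ ∧ ∃ β : ℝ, vec n β γ ∈ Γ ∧ f (vec n β γ) = 1})
    (hγ₀0 : 0 ≤ γ₀) (hγ₀cstar : γ₀ < cstar) :
    (∀ γ : ℝ, γ₀ < γ → ∃! β : ℝ, vec n β γ ∈ Γ ∧ f (vec n β γ) = 1) ∧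
    (vec n cstar cstar ∈ Γ ∧ f (vec n cstar cstar) = 1) ∧
    (∀ β : ℝ, vec n β cstar ∈ Γ → f (vec n β cstar) = 1 → β = cstar) ∧
    (∀ γ : ℝ, cstar < γ → ∀ β : ℝ, vec n β γ ∈ Γ → f (vec n β γ) = 1 → β < cstar) := by
  have hn0 : 0 < n := by omega
  have hadd : ∀ x ∈ Γ, ∀ d : Fin n → ℝ, 0 ≤ d → x + d ∈ Γ := fun x hx d hd =>
    add_nonneg_mem_of_orthant_subset hΓopen hΓconv hΓcone hΓ1 hx hd
  have hlt : ∀ x ∈ Γ, ∀ y, x < y → f x < f y := fun x hx y hxy =>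
    lt_of_lt_of_fderiv_single_pos hΓopen hadd (hfsmooth.differentiableOn (by simp)) hfmono hx hxy
  have huniq : ∀ γ β β' : ℝ, vec n β γ ∈ Γ → vec n β' γ ∈ Γ →
      f (vec n β γ) = f (vec n β' γ) → β = β' := by
    intro γ β β' hβ hβ' heq
    rcases lt_trichotomy β β' with h | h | h
    · exact absurd heq (hlt _ hβ _ (vec_lt_vec_left hn0 γ h)).ne
    · exact h
    · exact absurd heq (hlt _ hβ' _ (vec_lt_vec_left hn0 γ h)).ne'
  have hcmem : vec n cstar cstar ∈ Γ := hΓ1 fun j => by simpa [vec] using hcstar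
  have hcval : f (vec n cstar cstar) = 1 := by rw [vec_self, hfcstar]
  refine ⟨fun γ hγ => ?_, ⟨hcmem, hcval⟩,
    fun β hβ hfβ => huniq cstar β cstar hβ hcmem (hfβ.trans hcval.symm),
    fun γ hγ β hβ hfβ => ?_⟩
  · obtain ⟨γ₁, ⟨-, β₁, hmem₁, hval₁⟩, hγ₁⟩ :=
      exists_lt_of_csInf_lt (by exact ⟨cstar, hcstar, cstar, hcmem, hcval⟩) (hγ₀ ▸ hγ)
    have hvec := vec_lt_vec_right hn (le_refl β₁) hγ₁
    have hmem : vec n β₁ γ ∈ Γ := by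
      have h := hadd _ hmem₁ _ (sub_nonneg.2 hvec.le)
      rwa [add_sub_cancel] at h
    have hle : 1 ≤ f (vec n β₁ γ) := hval₁ ▸ (hlt _ hmem₁ _ hvec).le
    obtain ⟨β, hβ, hfβ⟩ := exists_vec_mem_eq hn0 hΓopen hadd hΓ2 hfcont hfbd hmem one_pos hle
    exact ⟨β, ⟨hβ, hfβ⟩, fun β' h => huniq γ β' β h.1 hβ (h.2.trans hfβ.symm)⟩
  · by_contra! hle
    have h := hlt _ hcmem _ (vec_lt_vec_right hn hle hγ)
    rw [hcval, hfβ] at h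
    exact lt_irrefl _ h
end

section
/- Let n ≥ 3, 2 ≤ k ≤ n, a = (1/C(n,k))^{1/k} where C(n,k) is the binomial coefficient, and â, ĉ ∈ ℝ. There exists a unique φ ∈ C¹([1, +∞)) ∩ C²((1, +∞)) such that for every r > 1 the vector λ(r) = (φ″(r), φ′(r)/r, …, φ′(r)/r) ∈ ℝⁿ satisfies σ_j(λ(r)) > 0 for j = 1, …, k and σ_k(λ(r)) = 1, φ(1) = â, and φ(r) = (a/2) r² + ĉ + O(r^{2−n}) as r → ∞, if and only if ĉ ≥ C* := â − a/2 + a ∫₁^∞ s ((1 − s^{−n})^{1/k} − 1) ds. (Equivalently, there exists a unique radially symmetric solution u(x) = φ(|x|) ∈ C²(ℝⁿ∖closure(B₁)) ∩ C¹(ℝⁿ∖B₁) of σ_k(λ(D²u)) = 1 in ℝⁿ∖closure(B₁) with λ(D²u) ∈ Γ_k, u = â on ∂B₁, and u = (a/2)|x|² + ĉ + O(|x|^{2−n}) as |x| → ∞, if and only if ĉ ≥ C*.) -/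
open Set Filter MeasureTheory Asymptotics

/-- The `k`-th elementary symmetric polynomial `σ_k(λ)` of `λ ∈ ℝⁿ`. -/
def esym (n k : ℕ) (lam : Fin n → ℝ) : ℝ :=
  ∑ s ∈ Finset.univ.powersetCard k, ∏ i ∈ s, lam i

/-- `φ` represents a radially symmetric solution `u(x) = φ(|x|)` of the Hessian equation
`σ_k(λ(D²u)) = 1` outside the closed unit ball with `λ(D²u) ∈ Γ_k`, `u = â` on `∂B₁`,
and `u = (a/2)|x|² + ĉ + O(|x|^{2−n})` as `|x| → ∞`. -/
def IsHessianRadialSol (n k : ℕ) (a ahat chat : ℝ) (φ : ℝ → ℝ) : Prop :=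
  ContDiffOn ℝ 1 φ (Set.Ici 1) ∧ ContDiffOn ℝ 2 φ (Set.Ioi 1) ∧
  (∀ r : ℝ, 1 < r →
    (∀ j : ℕ, 1 ≤ j → j ≤ k →
        0 < esym n j (vec n (deriv (deriv φ) r) (deriv φ r / r))) ∧
      esym n k (vec n (deriv (deriv φ) r) (deriv φ r / r)) = 1) ∧
  φ 1 = ahat ∧
  (fun r : ℝ => φ r - (a / 2 * r ^ 2 + chat)) =O[atTop] (fun r : ℝ => r ^ ((2 : ℝ) - n))

lemma esym_succ_vec (m i : ℕ) (β γ : ℝ) :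
    esym (m + 1) (i + 1) (vec (m + 1) β γ) =
      m.choose (i + 1) * γ ^ (i + 1) + m.choose i * (β * γ ^ i) := by
  classical
  have hu : (Finset.univ : Finset (Fin (m + 1))) = insert 0 (Finset.univ.erase 0) := by simp
  have hcard : (Finset.univ.erase (0 : Fin (m + 1))).card = m := by simp
  have hprod : ∀ (j : ℕ), ∀ t ∈ (Finset.univ.erase (0 : Fin (m + 1))).powersetCard j,
      ∏ x ∈ t, vec (m + 1) β γ x = γ ^ j := by
    intro j t ht
    rw [Finset.mem_powersetCard] at ht
    rw [← ht.2]
    refine Finset.prod_eq_pow_card fun x hx => ?_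
    have hx0 : x ≠ 0 := Finset.ne_of_mem_erase (ht.1 hx)
    simp [vec, hx0]
  have hnot : ∀ (j : ℕ), ∀ t ∈ (Finset.univ.erase (0 : Fin (m + 1))).powersetCard j,
      (0 : Fin (m + 1)) ∉ t := by
    intro j t ht h0
    exact Finset.notMem_erase _ _ ((Finset.mem_powersetCard.1 ht).1 h0)
  rw [esym, hu, Finset.powersetCard_succ_insert (Finset.notMem_erase _ _), Finset.sum_union]
  · congr 1
    · rw [Finset.sum_congr rfl (hprod _), Finset.sum_const, Finset.card_powersetCard, hcard,
        nsmul_eq_mul]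
    · rw [Finset.sum_image]
      · have : ∀ t ∈ (Finset.univ.erase (0 : Fin (m + 1))).powersetCard i,
            ∏ x ∈ insert 0 t, vec (m + 1) β γ x = β * γ ^ i := by
          intro t ht
          rw [Finset.prod_insert (hnot _ t ht), hprod _ t ht]
          simp [vec]
        rw [Finset.sum_congr rfl this, Finset.sum_const, Finset.card_powersetCard, hcard,
          nsmul_eq_mul]
      · intro s hs t ht hst
        rw [← Finset.erase_insert (hnot _ s hs), ← Finset.erase_insert (hnot _ t ht), hst]
  · rw [Finset.disjoint_left]
    intro t ht ht'
    obtain ⟨s, -, rfl⟩ := Finset.mem_image.1 ht'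
    exact hnot _ _ ht (Finset.mem_insert_self _ _)

lemma mul_esym_vec {n j : ℕ} (hn : 1 ≤ n) (hj : 1 ≤ j) (β γ : ℝ) :
    (n : ℝ) * esym n j (vec n β γ) =
      n.choose j * γ ^ (j - 1) * (j * β + (n - j) * γ) := by
  obtain ⟨m, rfl⟩ := Nat.exists_eq_add_of_le' hn
  obtain ⟨i, rfl⟩ := Nat.exists_eq_add_of_le' hj
  have h1 : ((m : ℝ) + 1) * m.choose i = (m + 1).choose (i + 1) * (i + 1) := by
    exact_mod_cast Nat.add_one_mul_choose_eq m i
  have h2 : ((m + 1).choose (i + 1) : ℝ) = m.choose i + m.choose (i + 1) := by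
    exact_mod_cast Nat.choose_succ_succ m i
  rw [esym_succ_vec, add_tsub_cancel_right, pow_succ]
  push_cast
  linear_combination (β - γ) * γ ^ i * h1 - (m + 1) * γ ^ i * γ * h2

lemma pos_of_esym_pos {n : ℕ} (hn : 3 ≤ n) {β γ : ℝ} (h1 : 0 < esym n 1 (vec n β γ))
    (h2 : 0 < esym n 2 (vec n β γ)) : 0 < γ := by
  have hn' : (3 : ℝ) ≤ n := by exact_mod_cast hn
  have e1 := mul_esym_vec (n := n) (by omega) le_rfl β γ
  have e2 := mul_esym_vec (n := n) (j := 2) (by omega) (by omega) β γ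
  have p1 : 0 < (n : ℝ) * esym n 1 (vec n β γ) := by positivity
  have p2 : 0 < (n : ℝ) * esym n 2 (vec n β γ) := by positivity
  have c2 : (0 : ℝ) < n.choose 2 := by exact_mod_cast Nat.choose_pos (by omega)
  rw [e1] at p1
  rw [e2, mul_assoc] at p2
  have p3 := pos_of_mul_pos_right p2 c2.le
  simp only [Nat.choose_one_right, tsub_self, pow_zero, mul_one, Nat.cast_one, one_mul] at p1
  have p4 := pos_of_mul_pos_right p1 (by positivity)
  norm_num at p3
  by_contra! h
  nlinarith [mul_nonneg_of_nonpos_of_nonpos h h, mul_nonneg (neg_nonneg.2 h) p4.le]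

lemma esym_pos_of_le {n j k : ℕ} (hj : 1 ≤ j) (hjk : j ≤ k) (hkn : k ≤ n) {β γ : ℝ}
    (hγ : 0 < γ) (hk : esym n k (vec n β γ) = 1) : 0 < esym n j (vec n β γ) := by
  have hn : (0 : ℝ) < n := by exact_mod_cast (by omega : 0 < n)
  have hj0 : (0 : ℝ) < j := by exact_mod_cast hj
  have hk0 : (0 : ℝ) < k := by exact_mod_cast (by omega : 0 < k)
  have hjk' : (j : ℝ) ≤ k := by exact_mod_cast hjk
  have ek := mul_esym_vec (n := n) (by omega) (hj.trans hjk) β γ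
  have ej := mul_esym_vec (n := n) (by omega) hj β γ
  have ck : (0 : ℝ) < n.choose k := by exact_mod_cast Nat.choose_pos hkn
  have cj : (0 : ℝ) < n.choose j := by exact_mod_cast Nat.choose_pos (hjk.trans hkn)
  rw [hk, mul_one] at ek
  have pk : 0 < k * β + (n - k) * γ := by
    refine pos_of_mul_pos_right (a := n.choose k * γ ^ (k - 1)) ?_ (by positivity)
    rw [← ek]; exact hn
  have pj : 0 < j * β + (n - j) * γ := by
    have : k * (j * β + (n - j) * γ) = j * (k * β + (n - k) * γ) + (k - j) * (n * γ) := by ring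
    refine pos_of_mul_pos_right (a := (k : ℝ)) ?_ hk0.le
    rw [this]
    have := mul_nonneg (sub_nonneg.2 hjk') (mul_pos hn hγ).le
    positivity
  refine pos_of_mul_pos_right (a := (n : ℝ)) ?_ hn.le
  rw [ej]; positivity

lemma abs_one_add_rpow_sub_one_le {x p : ℝ} (hx : -1 ≤ x) (hp0 : 0 ≤ p) (hp1 : p ≤ 1) :
    |(1 + x) ^ p - 1| ≤ |x| := by
  rcases le_total 0 x with h | h
  · have h1 : (1 + x) ^ p ≤ (1 + x) ^ (1 : ℝ) :=
      Real.rpow_le_rpow_of_exponent_le (by linarith) hp1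
    have h2 : 1 ≤ (1 + x) ^ p := Real.one_le_rpow (by linarith) hp0
    rw [Real.rpow_one] at h1
    rw [abs_of_nonneg h, abs_of_nonneg] <;> linarith
  · have h2 : (1 + x) ^ p ≤ 1 := Real.rpow_le_one (by linarith) (by linarith) hp0
    have h1 : 1 + x ≤ (1 + x) ^ p := Real.self_le_rpow_of_le_one (by linarith) (by linarith) hp1
    rw [abs_of_nonpos h, abs_of_nonpos] <;> linarith

/-- The deviation of the normalized slope of a radial solution from the slope `s` of the
quadratic profile. -/
noncomputable def excess (n k : ℕ) (α s : ℝ) : ℝ :=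
  s * ((1 + α * (s ^ n)⁻¹) ^ ((1 : ℝ) / k) - 1)

lemma neg_one_le_mul_inv_pow {α s : ℝ} (n : ℕ) (hα : -1 ≤ α) (hs : 1 ≤ s) :
    -1 ≤ α * (s ^ n)⁻¹ := by
  have h1 : (s ^ n)⁻¹ ≤ 1 := inv_le_one_of_one_le₀ (one_le_pow₀ hs)
  have h0 : 0 ≤ (s ^ n)⁻¹ := by positivity
  nlinarith

lemma one_add_mul_inv_pow_pos {n : ℕ} (hn : n ≠ 0) {α s : ℝ} (hα : -1 ≤ α) (hs : 1 < s) :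
    0 < 1 + α * (s ^ n)⁻¹ := by
  have h1 : (s ^ n)⁻¹ < 1 := inv_lt_one_of_one_lt₀ (one_lt_pow₀ hs hn)
  have h0 : 0 < (s ^ n)⁻¹ := by positivity
  nlinarith

lemma abs_excess_le {n k : ℕ} (hk : 1 ≤ k) {α s : ℝ} (hα : -1 ≤ α) (hs : 1 ≤ s) :
    |excess n k α s| ≤ |α| * s ^ ((1 : ℝ) - n) := by
  have hk' : (1 : ℝ) ≤ k := by exact_mod_cast hk
  have hs0 : 0 < s := by linarith
  have h := abs_one_add_rpow_sub_one_le (neg_one_le_mul_inv_pow n hα hs)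
    (p := (1 : ℝ) / k) (by positivity) ((div_le_one (by linarith)).2 hk')
  rw [excess, abs_mul, abs_of_pos hs0, Real.rpow_sub hs0, Real.rpow_one, Real.rpow_natCast]
  rw [abs_mul, abs_of_pos (a := (s ^ n)⁻¹) (by positivity)] at h
  calc _ ≤ s * (|α| * (s ^ n)⁻¹) := by gcongr
    _ = _ := by rw [div_eq_mul_inv]; ring

lemma measurable_excess (n k : ℕ) (α : ℝ) : Measurable (excess n k α) := by
  unfold excess; fun_prop

lemma integrableOn_rpow_one_sub {n : ℕ} (hn : 3 ≤ n) {r : ℝ} (hr : 1 ≤ r) :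
    IntegrableOn (fun s : ℝ => s ^ ((1 : ℝ) - n)) (Ioi r) := by
  have hn' : (3 : ℝ) ≤ n := by exact_mod_cast hn
  exact integrableOn_Ioi_rpow_of_lt (by linarith) (by linarith)

lemma integrableOn_excess {n k : ℕ} (hn : 3 ≤ n) (hk : 1 ≤ k) {α r : ℝ} (hα : -1 ≤ α)
    (hr : 1 ≤ r) : IntegrableOn (excess n k α) (Ioi r) := by
  refine Integrable.mono' ((integrableOn_rpow_one_sub hn hr).const_mul |α|)
    (measurable_excess n k α).aestronglyMeasurable ?_
  filter_upwards [ae_restrict_mem measurableSet_Ioi] with s hs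
  exact abs_excess_le hk hα (hr.trans (le_of_lt hs))

lemma abs_integral_excess_le {n k : ℕ} (hn : 3 ≤ n) (hk : 1 ≤ k) {α r : ℝ} (hα : -1 ≤ α)
    (hr : 1 ≤ r) :
    |∫ s in Ioi r, excess n k α s| ≤ |α| / (n - 2) * r ^ ((2 : ℝ) - n) := by
  have hn' : (3 : ℝ) ≤ n := by exact_mod_cast hn
  have h : ‖∫ s in Ioi r, excess n k α s‖ ≤ ∫ s in Ioi r, |α| * s ^ ((1 : ℝ) - n) := by
    refine norm_integral_le_of_norm_le ((integrableOn_rpow_one_sub hn hr).const_mul |α|) ?_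
    filter_upwards [ae_restrict_mem measurableSet_Ioi] with s hs
    exact abs_excess_le hk hα (hr.trans (le_of_lt hs))
  rw [integral_const_mul, integral_Ioi_rpow_of_lt (by linarith) (by linarith)] at h
  refine h.trans (le_of_eq ?_)
  have e : (1 : ℝ) - n + 1 = 2 - n := by ring
  have h2 : (2 : ℝ) - n ≠ 0 := by linarith
  have h3 : (n : ℝ) - 2 ≠ 0 := by linarith
  rw [e]
  field_simp
  ring

lemma excess_lt_excess {n k : ℕ} (hk : 1 ≤ k) {α α' s : ℝ} (hα : -1 ≤ α) (h : α < α')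
    (hs : 1 ≤ s) : excess n k α s < excess n k α' s := by
  have h1 := neg_one_le_mul_inv_pow n hα hs
  have hk' : (0 : ℝ) < k := by exact_mod_cast hk
  have : 0 < (s ^ n)⁻¹ := by positivity
  unfold excess
  gcongr
  linarith

lemma strictMonoOn_integral_excess {n k : ℕ} (hn : 3 ≤ n) (hk : 1 ≤ k) :
    StrictMonoOn (fun α => ∫ s in Ioi (1 : ℝ), excess n k α s) (Ici (-1)) := by
  intro α hα α' hα' h
  have hi := integrableOn_excess hn hk hα le_rfl
  have hi' := integrableOn_excess hn hk hα' le_rfl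
  have hd : IntegrableOn (fun s => excess n k α' s - excess n k α s) (Ioi 1) := hi'.sub hi
  rw [← sub_pos, ← integral_sub hi' hi, setIntegral_pos_iff_support_of_nonneg_ae _ hd]
  · have : Ioi (1 : ℝ) ⊆
        (Function.support fun s => excess n k α' s - excess n k α s) ∩ Ioi 1 := fun s hs =>
      ⟨(sub_pos.2 (excess_lt_excess hk hα h (le_of_lt hs))).ne', hs⟩
    exact lt_of_lt_of_le (by simp) (measure_mono this)
  · filter_upwards [ae_restrict_mem measurableSet_Ioi] with s hs
    exact (sub_pos.2 (excess_lt_excess hk hα h (le_of_lt hs))).le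

lemma continuousOn_integral_excess {n k : ℕ} (hn : 3 ≤ n) (hk : 1 ≤ k) (M : ℝ) :
    ContinuousOn (fun α => ∫ s in Ioi (1 : ℝ), excess n k α s) (Icc (-1) M) := by
  refine continuousOn_of_dominated (bound := fun s => max 1 M * s ^ ((1 : ℝ) - n)) ?_ ?_ ?_ ?_
  · exact fun α _ => (measurable_excess n k α).aestronglyMeasurable
  · intro α hα
    filter_upwards [ae_restrict_mem measurableSet_Ioi] with s hs
    have hs0 : (0 : ℝ) ≤ s := zero_le_one.trans (le_of_lt hs)
    refine (abs_excess_le hk hα.1 (le_of_lt hs)).trans ?_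
    gcongr
    rw [abs_le]
    constructor
    · linarith [hα.1, le_max_left 1 M]
    · exact hα.2.trans (le_max_right 1 M)
  · exact (integrableOn_rpow_one_sub hn le_rfl).const_mul _
  · refine Eventually.of_forall fun s => Continuous.continuousOn ?_
    unfold excess
    have : (0 : ℝ) ≤ 1 / k := by positivity
    fun_prop (disch := assumption)

lemma le_integral_excess {n k : ℕ} (hn : 3 ≤ n) (hk : 1 ≤ k) {T : ℝ} (hT : 0 ≤ T) :
    T ≤ ∫ s in Ioi (1 : ℝ), excess n k (2 ^ n * ((1 + T) ^ k - 1)) s := by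
  set α : ℝ := 2 ^ n * ((1 + T) ^ k - 1) with hα
  have hT1 : 1 ≤ (1 + T) ^ k := one_le_pow₀ (by linarith)
  have hα0 : 0 ≤ α := mul_nonneg (by positivity) (by linarith)
  have hi := integrableOn_excess hn hk (by linarith : -1 ≤ α) le_rfl
  have hk' : (0 : ℝ) < k := by exact_mod_cast hk
  have hnonneg : ∀ s : ℝ, 1 ≤ s → 0 ≤ excess n k α s := by
    intro s hs
    have h0 : 0 ≤ α * (s ^ n)⁻¹ := by positivity
    have : (1 : ℝ) ≤ (1 + α * (s ^ n)⁻¹) ^ ((1 : ℝ) / k) :=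
      Real.one_le_rpow (by linarith) (by positivity)
    exact mul_nonneg (by linarith) (by linarith)
  have hle : ∀ s ∈ Ioc (1 : ℝ) 2, T ≤ excess n k α s := by
    intro s hs
    have h1 : (1 + T) ^ k ≤ 1 + α * (s ^ n)⁻¹ := by
      have : (s : ℝ) ^ n ≤ 2 ^ n := pow_le_pow_left₀ (by linarith [hs.1]) hs.2 n
      have : 1 ≤ (2 : ℝ) ^ n * (s ^ n)⁻¹ := by
        rw [← div_eq_mul_inv, le_div_iff₀ (pow_pos (by linarith [hs.1]) n)]
        linarith
      have h2 := mul_le_mul_of_nonneg_left this (sub_nonneg.2 hT1)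
      rw [hα]
      linarith
    have h2 : 1 + T ≤ (1 + α * (s ^ n)⁻¹) ^ ((1 : ℝ) / k) := by
      calc 1 + T = ((1 + T) ^ k) ^ ((1 : ℝ) / k) := by
            rw [one_div, Real.pow_rpow_inv_natCast (by linarith) (by omega)]
        _ ≤ _ := by gcongr
    unfold excess
    nlinarith [hs.1]
  calc T = ∫ s in Ioc (1 : ℝ) 2, T := by simp; norm_num
    _ ≤ ∫ s in Ioc (1 : ℝ) 2, excess n k α s :=
        setIntegral_mono_on (by simp) (hi.mono_set Ioc_subset_Ioi_self) measurableSet_Ioc hle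
    _ ≤ _ := by
        refine setIntegral_mono_set hi ?_ (LE.le.eventuallyLE Ioc_subset_Ioi_self)
        filter_upwards [ae_restrict_mem measurableSet_Ioi] with s hs
        exact hnonneg s (le_of_lt hs)

lemma exists_integral_excess_eq {n k : ℕ} (hn : 3 ≤ n) (hk : 1 ≤ k) {y : ℝ}
    (hy : ∫ s in Ioi (1 : ℝ), excess n k (-1) s ≤ y) :
    ∃ α, -1 ≤ α ∧ ∫ s in Ioi (1 : ℝ), excess n k α s = y := by
  set M : ℝ := 2 ^ n * ((1 + max y 0) ^ k - 1)
  have hM : y ≤ ∫ s in Ioi (1 : ℝ), excess n k M s :=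
    (le_max_left y 0).trans (le_integral_excess hn hk (le_max_right y 0))
  have hT1 : 1 ≤ (1 + max y 0) ^ k := one_le_pow₀ (by linarith [le_max_right y 0])
  have hM0 : 0 ≤ M := mul_nonneg (by positivity) (by linarith)
  obtain ⟨α, hα, h⟩ := intermediate_value_Icc (by linarith : -1 ≤ M)
    (continuousOn_integral_excess hn hk M) ⟨hy, hM⟩
  exact ⟨α, hα.1, h⟩

/-- A continuous extension to `ℝ` of the slope of the radial solution with parameter `α`. -/
noncomputable def radialSlope (n k : ℕ) (a α s : ℝ) : ℝ :=
  a * s * (1 + α * (max s 1 ^ n)⁻¹) ^ ((1 : ℝ) / k)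

/-- The radial solution with parameter `α` and boundary value `ahat`. -/
noncomputable def radialProfile (n k : ℕ) (a ahat α r : ℝ) : ℝ :=
  ahat + ∫ s in (1 : ℝ)..r, radialSlope n k a α s

lemma continuous_radialSlope (n k : ℕ) (a α : ℝ) : Continuous (radialSlope n k a α) := by
  have hk : (0 : ℝ) ≤ 1 / k := by positivity
  have hm : ∀ s : ℝ, max s 1 ^ n ≠ 0 := fun s =>
    (pow_pos (zero_lt_one.trans_le (le_max_right s 1)) n).ne'
  unfold radialSlope
  exact (continuous_const.mul continuous_id).mul ((continuous_const.add (continuous_const.mul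
    (((continuous_id.max continuous_const).pow n).inv₀ hm))).rpow_const fun _ => Or.inr hk)

lemma hasDerivAt_radialProfile (n k : ℕ) (a ahat α r : ℝ) :
    HasDerivAt (radialProfile n k a ahat α) (radialSlope n k a α r) r :=
  ((continuous_radialSlope n k a α).integral_hasStrictDerivAt 1 r).hasDerivAt.const_add ahat

lemma radialSlope_of_one_le {n k : ℕ} {a α s : ℝ} (hs : 1 ≤ s) :
    radialSlope n k a α s = a * s + a * excess n k α s := by
  rw [radialSlope, excess, max_eq_left hs]; ring

lemma radialProfile_eq {n k : ℕ} (hn : 3 ≤ n) (hk : 1 ≤ k) {a ahat α r : ℝ} (hα : -1 ≤ α)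
    (hr : 1 ≤ r) :
    radialProfile n k a ahat α r = a / 2 * r ^ 2 +
      (ahat - a / 2 + a * ∫ s in Ioi (1 : ℝ), excess n k α s) -
        a * ∫ s in Ioi r, excess n k α s := by
  have hi := integrableOn_excess hn hk hα le_rfl
  have hir : IntervalIntegrable (excess n k α) volume 1 r :=
    (intervalIntegrable_iff_integrableOn_Ioc_of_le hr).2 (hi.mono_set Ioc_subset_Ioi_self)
  have h1 : ∫ s in (1 : ℝ)..r, radialSlope n k a α s =
      ∫ s in (1 : ℝ)..r, (a * s + a * excess n k α s) := by
    refine intervalIntegral.integral_congr fun s hs => radialSlope_of_one_le ?_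
    rw [uIcc_of_le hr] at hs
    exact hs.1
  have h2 := intervalIntegral.integral_interval_add_Ioi hi (integrableOn_excess hn hk hα hr)
  rw [radialProfile, h1, intervalIntegral.integral_add
    ((continuous_const_mul a).intervalIntegrable _ _) (hir.const_mul a),
    intervalIntegral.integral_const_mul, intervalIntegral.integral_const_mul, integral_id, ← h2]
  ring

lemma radialProfile_isBigO {n k : ℕ} (hn : 3 ≤ n) (hk : 1 ≤ k) (a ahat : ℝ) {α : ℝ}
    (hα : -1 ≤ α) :
    (fun r : ℝ => radialProfile n k a ahat α r - (a / 2 * r ^ 2 +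
      (ahat - a / 2 + a * ∫ s in Ioi (1 : ℝ), excess n k α s)))
        =O[atTop] (fun r : ℝ => r ^ ((2 : ℝ) - n)) := by
  refine IsBigO.of_bound (|a| * (|α| / (n - 2))) ?_
  filter_upwards [eventually_ge_atTop 1] with r hr
  rw [radialProfile_eq hn hk hα hr, sub_sub_cancel_left, norm_neg, norm_mul, mul_assoc,
    Real.norm_of_nonneg (Real.rpow_nonneg (zero_le_one.trans hr) _)]
  exact mul_le_mul_of_nonneg_left (abs_integral_excess_le hn hk hα hr) (abs_nonneg a)

lemma hasDerivAt_radialSlope {n k : ℕ} (hn : n ≠ 0) (a : ℝ) {α r : ℝ} (hα : -1 ≤ α)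
    (hr : 1 < r) :
    HasDerivAt (radialSlope n k a α)
      (a * (1 + α * (r ^ n)⁻¹) ^ ((1 : ℝ) / k) + a * r *
        (α * (-(n * r ^ (n - 1)) / (r ^ n) ^ 2) * ((1 : ℝ) / k) *
          (1 + α * (r ^ n)⁻¹) ^ ((1 : ℝ) / k - 1))) r := by
  have hq := one_add_mul_inv_pow_pos hn hα hr
  have hr0 : r ^ n ≠ 0 := pow_ne_zero _ (by linarith)
  have h1 := ((((hasDerivAt_pow n r).inv hr0).const_mul α).const_add 1).rpow_const
    (p := (1 : ℝ) / k) (Or.inl hq.ne')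
  have h2 := ((hasDerivAt_id r).const_mul a).mul h1
  rw [mul_one] at h2
  refine h2.congr_of_eventuallyEq ?_
  filter_upwards [Ioi_mem_nhds hr] with s hs
  simp [radialSlope, max_eq_left (mem_Ioi.1 hs).le]

lemma esym_radialSlope {n k : ℕ} (hk : 1 ≤ k) (hkn : k ≤ n) {a α r : ℝ}
    (ha : n.choose k * a ^ k = 1) (hα : -1 ≤ α) (hr : 1 < r) :
    esym n k (vec n (deriv (radialSlope n k a α) r) (radialSlope n k a α r / r)) = 1 := by
  have hn : n ≠ 0 := by omega
  have hn0 : (n : ℝ) ≠ 0 := by exact_mod_cast hn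
  have hk0 : (k : ℝ) ≠ 0 := by exact_mod_cast (by omega : k ≠ 0)
  have hr0 : r ≠ 0 := by linarith
  have hq := one_add_mul_inv_pow_pos hn hα hr
  have hγ : radialSlope n k a α r / r = a * (1 + α * (r ^ n)⁻¹) ^ ((1 : ℝ) / k) := by
    rw [radialSlope, max_eq_left hr.le]
    field_simp
  refine mul_left_cancel₀ hn0 ?_
  rw [mul_esym_vec (by omega) hk, (hasDerivAt_radialSlope hn a hα hr).deriv, hγ,
    Real.rpow_sub_one hq.ne']
  obtain ⟨m, rfl⟩ := Nat.exists_eq_add_of_le' (Nat.one_le_iff_ne_zero.2 hn)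
  have hpow : ((1 + α * (r ^ (m + 1))⁻¹) ^ ((1 : ℝ) / k)) ^ k = 1 + α * (r ^ (m + 1))⁻¹ := by
    rw [one_div, Real.rpow_inv_natCast_pow hq.le (by omega)]
  obtain ⟨i, rfl⟩ := Nat.exists_eq_add_of_le' hk
  set q := 1 + α * (r ^ (m + 1))⁻¹ with hqdef
  set g := q ^ ((1 : ℝ) / (i + 1 : ℕ))
  have hα' : α = (q - 1) * r ^ (m + 1) := by
    rw [hqdef]; field_simp; ring
  have key : ((i + 1 : ℕ) : ℝ) * (a * g + a * r *
      (α * (-((m + 1 : ℕ) * r ^ (m + 1 - 1)) / (r ^ (m + 1)) ^ 2) * ((1 : ℝ) / (i + 1 : ℕ)) *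
        (g / q))) + ((m + 1 : ℕ) - (i + 1 : ℕ)) * (a * g) = (m + 1 : ℕ) * (a * (g / q)) := by
    rw [hα', add_tsub_cancel_right]
    have := hq.ne'
    field_simp
    ring
  rw [key, add_tsub_cancel_right]
  calc _ = ((m + 1 : ℕ) : ℝ) * ((m + 1).choose (i + 1) * a ^ (i + 1)) * (g ^ (i + 1) / q) := by
        ring
    _ = _ := by rw [ha, hpow, div_self hq.ne', mul_one]

lemma contDiffOn_radialSlope {n k : ℕ} (hn : n ≠ 0) (a : ℝ) {α : ℝ} (hα : -1 ≤ α) :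
    ContDiffOn ℝ 1 (radialSlope n k a α) (Ioi 1) := by
  have h : ContDiffOn ℝ 1
      (fun s : ℝ => a * s * (1 + α * (s ^ n)⁻¹) ^ ((1 : ℝ) / k)) (Ioi 1) := by
    refine (contDiffOn_const.mul contDiffOn_id).mul (ContDiffOn.rpow_const_of_ne
      (contDiffOn_const.add (contDiffOn_const.mul ((contDiffOn_id.pow n).inv ?_))) ?_)
    · exact fun s hs => pow_ne_zero _ (zero_lt_one.trans hs).ne'
    · exact fun s hs => (one_add_mul_inv_pow_pos hn hα hs).ne'
  refine h.congr fun s hs => ?_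
  rw [radialSlope, max_eq_left (le_of_lt hs)]

lemma isHessianRadialSol_radialProfile {n k : ℕ} (hn : 3 ≤ n) (hk : 1 ≤ k) (hkn : k ≤ n)
    {a : ℝ} (ha0 : 0 < a) (ha : n.choose k * a ^ k = 1) (ahat : ℝ) {α : ℝ} (hα : -1 ≤ α) :
    IsHessianRadialSol n k a ahat (ahat - a / 2 + a * ∫ s in Ioi (1 : ℝ), excess n k α s)
      (radialProfile n k a ahat α) := by
  have hn0 : n ≠ 0 := by omega
  have hderiv : deriv (radialProfile n k a ahat α) = radialSlope n k a α :=
    funext fun r => (hasDerivAt_radialProfile n k a ahat α r).deriv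
  have hdiff : Differentiable ℝ (radialProfile n k a ahat α) := fun r =>
    (hasDerivAt_radialProfile n k a ahat α r).differentiableAt
  refine ⟨?_, ?_, fun r hr => ?_, ?_, radialProfile_isBigO hn hk a ahat hα⟩
  · refine (contDiff_one_iff_deriv.2 ⟨hdiff, ?_⟩).contDiffOn
    rw [hderiv]
    exact continuous_radialSlope n k a α
  · rw [← one_add_one_eq_two, contDiffOn_succ_iff_deriv_of_isOpen isOpen_Ioi, hderiv]
    exact ⟨hdiff.differentiableOn, by simp, contDiffOn_radialSlope hn0 a hα⟩
  · rw [hderiv]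
    have h1 := esym_radialSlope hk hkn ha hα hr
    refine ⟨fun j hj hjk => esym_pos_of_le hj hjk hkn ?_ h1, h1⟩
    have hq := one_add_mul_inv_pow_pos hn0 hα hr
    have hr0 : 0 < r := zero_lt_one.trans hr
    rw [radialSlope, max_eq_left hr.le]
    positivity
  · simp [radialProfile]

lemma neg_one_le_of_forall_one_add_pos (n : ℕ) {α : ℝ}
    (h : ∀ r : ℝ, 1 < r → 0 < 1 + α * (r ^ n)⁻¹) : -1 ≤ α := by
  have hc : ContinuousAt (fun r : ℝ => 1 + α * (r ^ n)⁻¹) 1 := by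
    refine continuousAt_const.add (continuousAt_const.mul ((continuousAt_id.pow n).inv₀ ?_))
    simp
  have h1 : 0 ≤ 1 + α * ((1 : ℝ) ^ n)⁻¹ :=
    ge_of_tendsto (hc.tendsto.mono_left nhdsWithin_le_nhds : Tendsto _ (nhdsWithin (1 : ℝ) (Ioi 1)) _)
      (by filter_upwards [self_mem_nhdsWithin] with r hr using (h r hr).le)
  simp at h1
  linarith

lemma IsHessianRadialSol.exists_deriv_eq {n k : ℕ} (hn : 3 ≤ n) (hk2 : 2 ≤ k) (hkn : k ≤ n)
    {a ahat chat : ℝ} (ha0 : 0 < a) (ha : n.choose k * a ^ k = 1) {φ : ℝ → ℝ}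
    (hφ : IsHessianRadialSol n k a ahat chat φ) :
    ∃ α, -1 ≤ α ∧ ∀ r, 1 < r → deriv φ r = radialSlope n k a α r := by
  obtain ⟨-, h2, hσ, -, -⟩ := hφ
  rw [← one_add_one_eq_two, contDiffOn_succ_iff_deriv_of_isOpen isOpen_Ioi] at h2
  have hdd : ∀ r, 1 < r → HasDerivAt (deriv φ) (deriv (deriv φ) r) r := fun r hr =>
    ((h2.2.2.differentiableOn (by simp)).differentiableAt (Ioi_mem_nhds hr)).hasDerivAt
  have hγ : ∀ r, 1 < r → 0 < deriv φ r / r := fun r hr =>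
    pos_of_esym_pos hn ((hσ r hr).1 1 le_rfl (by omega)) ((hσ r hr).1 2 (by omega) hk2)
  have hW : ∀ r ∈ Ioi (1 : ℝ),
      HasDerivAt (fun s => (deriv φ s / s) ^ k * s ^ n - a ^ k * s ^ n) 0 r := by
    intro r hr
    have hr0 : r ≠ 0 := (zero_lt_one.trans hr).ne'
    have h := ((((hdd r hr).div (hasDerivAt_id r) hr0).pow k).mul (hasDerivAt_pow n r)).sub
      ((hasDerivAt_pow n r).const_mul (a ^ k))
    refine h.congr_deriv ?_
    have he := mul_esym_vec (n := n) (j := k) (by omega) (by omega)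
      (deriv (deriv φ) r) (deriv φ r / r)
    rw [(hσ r hr).2, mul_one] at he
    have hd : deriv φ r = deriv φ r / r * r := by field_simp
    set β := deriv (deriv φ) r
    set γ := deriv φ r / r
    have hγ' : (β * r - deriv φ r * 1) / r ^ 2 = (β - γ) / r := by
      rw [hd]; field_simp
    obtain ⟨i, rfl⟩ := Nat.exists_eq_add_of_le' (one_le_two.trans hk2)
    obtain ⟨m, rfl⟩ := Nat.exists_eq_add_of_le' ((by norm_num : 1 ≤ 3).trans hn)
    simp only [id, Pi.div_apply, Pi.pow_apply, add_tsub_cancel_right] at he ⊢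
    rw [hγ']
    change ((i + 1 : ℕ) : ℝ) * γ ^ i * ((β - γ) / r) * r ^ (m + 1) +
      γ ^ (i + 1) * (((m + 1 : ℕ) : ℝ) * r ^ m) - a ^ (i + 1) * (((m + 1 : ℕ) : ℝ) * r ^ m) = 0
    have e1 : (β - γ) / r * r ^ (m + 1) = (β - γ) * r ^ m := by field_simp; ring
    have e2 : γ ^ i * (((i + 1 : ℕ) : ℝ) * β + ((m + 1 : ℕ) - (i + 1 : ℕ)) * γ) =
        (m + 1 : ℕ) * a ^ (i + 1) := by
      linear_combination -(γ ^ i * (((i + 1 : ℕ) : ℝ) * β + ((m + 1 : ℕ) - (i + 1 : ℕ)) * γ)) * ha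
        - a ^ (i + 1) * he
    linear_combination ((i + 1 : ℕ) : ℝ) * γ ^ i * e1 + r ^ m * e2
  obtain ⟨c, hc⟩ := isOpen_Ioi.exists_is_const_of_deriv_eq_zero isPreconnected_Ioi
    (fun r hr => (hW r hr).differentiableAt.differentiableWithinAt) fun r hr => (hW r hr).deriv
  have hak : a ^ k ≠ 0 := (pow_pos ha0 k).ne'
  have hq : ∀ r, 1 < r → (deriv φ r / r) ^ k = a ^ k * (1 + c / a ^ k * (r ^ n)⁻¹) := by
    intro r hr
    have hrn : r ^ n ≠ 0 := pow_ne_zero _ (zero_lt_one.trans hr).ne'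
    have := hc r hr
    field_simp
    linarith
  have hqpos : ∀ r : ℝ, 1 < r → 0 < 1 + c / a ^ k * (r ^ n)⁻¹ := by
    intro r hr
    have := pow_pos (hγ r hr) k
    rw [hq r hr] at this
    exact pos_of_mul_pos_right this (pow_pos ha0 k).le
  refine ⟨c / a ^ k, neg_one_le_of_forall_one_add_pos n hqpos, fun r hr => ?_⟩
  have hk0 : k ≠ 0 := by omega
  have h : deriv φ r / r = a * (1 + c / a ^ k * (r ^ n)⁻¹) ^ ((1 : ℝ) / k) := by
    rw [← Real.pow_rpow_inv_natCast (hγ r hr).le hk0, hq r hr,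
      Real.mul_rpow (pow_pos ha0 k).le (hqpos r hr).le, Real.pow_rpow_inv_natCast ha0.le hk0,
      one_div]
  rw [div_eq_iff (zero_lt_one.trans hr).ne'] at h
  rw [h, radialSlope, max_eq_left hr.le]
  ring

lemma IsHessianRadialSol.exists_eqOn {n k : ℕ} (hn : 3 ≤ n) (hk2 : 2 ≤ k) (hkn : k ≤ n)
    {a ahat chat : ℝ} (ha0 : 0 < a) (ha : n.choose k * a ^ k = 1) {φ : ℝ → ℝ}
    (hφ : IsHessianRadialSol n k a ahat chat φ) :
    ∃ α, -1 ≤ α ∧ EqOn φ (radialProfile n k a ahat α) (Ici 1) ∧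
      chat = ahat - a / 2 + a * ∫ s in Ioi (1 : ℝ), excess n k α s := by
  obtain ⟨α, hα, hd⟩ := hφ.exists_deriv_eq hn hk2 hkn ha0 ha
  obtain ⟨h1, h2, -, hφ1, hO⟩ := hφ
  have hP := hasDerivAt_radialProfile n k a ahat α
  have heq : EqOn φ (radialProfile n k a ahat α) (Ici 1) := by
    intro r hr
    rcases eq_or_lt_of_le (mem_Ici.1 hr) with rfl | hr
    · simp [hφ1, radialProfile]
    obtain ⟨s, hs, he⟩ := exists_hasDerivAt_eq_slope
      (fun s => φ s - radialProfile n k a ahat α s) (fun _ => 0) hr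
      ((h1.continuousOn.mono Icc_subset_Ici_self).sub
        fun s _ => (hP s).continuousAt.continuousWithinAt)
      (fun s hs => by
        have := (((h2.differentiableOn (by simp)).differentiableAt
          (Ioi_mem_nhds hs.1)).hasDerivAt).sub (hP s)
        rwa [hd s hs.1, sub_self] at this)
    rw [eq_comm, div_eq_zero_iff, or_iff_left (sub_pos.2 hr).ne'] at he
    have hP1 : radialProfile n k a ahat α 1 = ahat := by simp [radialProfile]
    rw [hφ1, hP1] at he
    linarith
  refine ⟨α, hα, heq, ?_⟩
  have hn' : (3 : ℝ) ≤ n := by exact_mod_cast hn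
  have h0 : Tendsto (fun r : ℝ => r ^ ((2 : ℝ) - n)) atTop (nhds 0) := by
    have := tendsto_rpow_neg_atTop (y := (n : ℝ) - 2) (by linarith)
    rwa [neg_sub] at this
  have ht := ((radialProfile_isBigO hn (one_le_two.trans hk2) a ahat hα).trans_tendsto h0).sub
    (hO.trans_tendsto h0)
  rw [sub_self] at ht
  refine sub_eq_zero.1 (tendsto_nhds_unique (tendsto_const_nhds.congr' ?_) ht)
  filter_upwards [eventually_ge_atTop 1] with r hr
  rw [heq hr]
  ring

/-- For `n ≥ 3`, `2 ≤ k ≤ n` and `a = (1/C(n,k))^{1/k}`: there exists a unique radially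
symmetric solution of `σ_k(λ(D²u)) = 1` outside the unit ball with `u = â` on `∂B₁` and
`u = (a/2)|x|² + ĉ + O(|x|^{2−n})`, if and only if
`ĉ ≥ C* = â − a/2 + a ∫₁^∞ s ((1 − s^{−n})^{1/k} − 1) ds`. -/
theorem stmt18 (n k : ℕ) (hn : 3 ≤ n) (hk2 : 2 ≤ k) (hkn : k ≤ n)
    (a : ℝ) (ha : a = (1 / (n.choose k : ℝ)) ^ ((1 : ℝ) / k))
    (ahat chat : ℝ)
    (Cs : ℝ)
    (hCs : Cs = ahat - a / 2 +
      a * ∫ s in Set.Ioi (1 : ℝ), s * ((1 - s ^ (-(n : ℝ))) ^ ((1 : ℝ) / k) - 1)) :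
    (∃ φ : ℝ → ℝ, IsHessianRadialSol n k a ahat chat φ ∧
        ∀ φ' : ℝ → ℝ, IsHessianRadialSol n k a ahat chat φ' → Set.EqOn φ' φ (Set.Ici 1)) ↔
      Cs ≤ chat := by
  have hk : 1 ≤ k := one_le_two.trans hk2
  have hC : (0 : ℝ) < n.choose k := by exact_mod_cast Nat.choose_pos hkn
  have ha0 : 0 < a := by rw [ha]; positivity
  have hak : n.choose k * a ^ k = 1 := by
    rw [ha, one_div (k : ℝ), Real.rpow_inv_natCast_pow (by positivity) (by omega)]
    field_simp
  have hCs' : Cs = ahat - a / 2 + a * ∫ s in Ioi (1 : ℝ), excess n k (-1) s := by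
    rw [hCs]
    congr 2
    refine setIntegral_congr_fun measurableSet_Ioi fun s hs => ?_
    have hs0 : (0 : ℝ) ≤ s := zero_le_one.trans (le_of_lt hs)
    simp only [excess, Real.rpow_neg hs0, Real.rpow_natCast]
    rw [neg_one_mul, ← sub_eq_add_neg]
  have hmono := strictMonoOn_integral_excess hn hk
  constructor
  · rintro ⟨φ, hφ, -⟩
    obtain ⟨α, hα, -, hc⟩ := hφ.exists_eqOn hn hk2 hkn ha0 hak
    have := hmono.monotoneOn (mem_Ici.2 le_rfl) hα hα
    rw [hCs', hc]
    gcongr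
  · intro h
    obtain ⟨α, hα, hint⟩ := exists_integral_excess_eq hn hk
      (y := (chat - (ahat - a / 2)) / a) (by rw [le_div_iff₀ ha0]; linarith)
    have hc : ahat - a / 2 + a * ∫ s in Ioi (1 : ℝ), excess n k α s = chat := by
      rw [hint]; field_simp; ring
    refine ⟨radialProfile n k a ahat α,
      hc ▸ isHessianRadialSol_radialProfile hn hk hkn ha0 hak ahat hα, fun φ' hφ' => ?_⟩
    obtain ⟨α', hα', heq, hc'⟩ := hφ'.exists_eqOn hn hk2 hkn ha0 hak
    have : α' = α := hmono.injOn hα' hα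
      (mul_left_cancel₀ ha0.ne' (add_left_cancel (hc'.symm.trans hc.symm)))
    rwa [this] at heq
end
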